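/- Let α ∈ (-1,1)\{0}, ρ = sqrt(1-α²), and define h(x) = -α(x+1)/r(x), R(x) = r(x)+α(1+x), S(x) = r(x)-α(1+x), with r(x) = sqrt((x-1)²+4α²x) > 0 on (-1,1). Then for x ∈ (-1,1)\{0} (with ε = ψ/φ as above), the explicit formula h_{n+1}(x) = h(x) · [ (1-ε^{n+1}(x))(S(x) - R(x)ε^{n+1}(x)) - ((n+1)/α)·((1-x)²/x)·r(x)·ε^{n+1}(x) ] / [ (1-ε^{n+1}(x))(S(x)+R(x)ε^{n+1}(x)) ] holds, where h_{n+1}(x) = (1-x²)b_{n+1}'(x)/(1-b_{n+1}(x)²). -/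

import Mathlib

noncomputable def gR (α x : ℝ) : ℝ := Real.sqrt ((x - 1) ^ 2 + 4 * α ^ 2 * x)

noncomputable def gPhi (α x : ℝ) : ℝ := x + 1 + gR α x

noncomputable def gPsi (α x : ℝ) : ℝ := x + 1 - gR α x

noncomputable def gEps (α x : ℝ) : ℝ := gPsi α x / gPhi α x

/-- `b_{n+1}` via its explicit formula in terms of `φ`, `ψ`, `ε`. -/
noncomputable def gB (α : ℝ) (n : ℕ) (x : ℝ) : ℝ :=
  (gPhi α x - 2 * (1 + α) - (gEps α x) ^ (n + 1) * (gPsi α x - 2 * (1 + α)))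
    / (gPhi α x - 2 * (1 + α) * x - (gEps α x) ^ (n + 1) * (gPsi α x - 2 * (1 + α) * x))


theorem aux_ident (a x r e m rp ep : ℝ) (hr2 : r ^ 2 = (x - 1) ^ 2 + 4 * a ^ 2 * x)
    (hrp : rp * r = x - 1 + 2 * a ^ 2) (hep : ep * (x * r) = m * e * (1 - x)) :
    (((1 + rp) - (ep * (x + 1 - r - 2 * (1 + a)) + e * (1 - rp))) *
        (x + 1 + r - 2 * (1 + a) * x - e * (x + 1 - r - 2 * (1 + a) * x)) -
      (x + 1 + r - 2 * (1 + a) - e * (x + 1 - r - 2 * (1 + a))) *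
        ((1 + rp - 2 * (1 + a)) - (ep * (x + 1 - r - 2 * (1 + a) * x)
          + e * (1 - rp - 2 * (1 + a))))) * (x * r) =
      -4 * (1 + a) * (a * x * (1 - e) * ((r - a * (1 + x)) - (r + a * (1 + x)) * e)
        - m * (1 - x) ^ 2 * r * e) := by
  have h1 : ((1 + rp) - (ep * (x + 1 - r - 2 * (1 + a)) + e * (1 - rp))) * (x * r) =
      x * (r + (x-1+2*a^2) - e * (r - (x-1+2*a^2))) - m*e*(1-x)*(x + 1 - r - 2 * (1 + a)) := by
    linear_combination (x + e * x) * hrp - (x + 1 - r - 2 * (1 + a)) * hep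
  have h2 : ((1 + rp - 2 * (1 + a)) - (ep * (x + 1 - r - 2 * (1 + a) * x)
          + e * (1 - rp - 2 * (1 + a)))) * (x * r) =
      x * (r + (x-1+2*a^2) - 2*(1+a)*r - e * (r - (x-1+2*a^2) - 2*(1+a)*r))
        - m*e*(1-x)*(x + 1 - r - 2 * (1 + a) * x) := by
    linear_combination (x + e * x) * hrp - (x + 1 - r - 2 * (1 + a) * x) * hep
  linear_combination (x + 1 + r - 2 * (1 + a) * x - e * (x + 1 - r - 2 * (1 + a) * x)) * h1
    - (x + 1 + r - 2 * (1 + a) - e * (x + 1 - r - 2 * (1 + a))) * h2 + (2 * (1 + a) * x * (1 - e ^ 2)) * hr2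

theorem stmt_17 (α : ℝ) (hα : α ∈ Set.Ioo (-1 : ℝ) 1) (hα0 : α ≠ 0) (n : ℕ) (x : ℝ)
    (hx : x ∈ Set.Ioo (-1 : ℝ) 1) (hx0 : x ≠ 0)
    (hD : gPhi α x - 2 * (1 + α) * x
        - (gEps α x) ^ (n + 1) * (gPsi α x - 2 * (1 + α) * x) ≠ 0)
    (hden : (1 - (gEps α x) ^ (n + 1)) *
        ((gR α x - α * (1 + x)) + (gR α x + α * (1 + x)) * (gEps α x) ^ (n + 1)) ≠ 0) :
    (1 - x ^ 2) * deriv (gB α n) x / (1 - (gB α n x) ^ 2)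
      = (-α * (x + 1) / gR α x) *
          ((1 - (gEps α x) ^ (n + 1)) *
              ((gR α x - α * (1 + x)) - (gR α x + α * (1 + x)) * (gEps α x) ^ (n + 1))
            - ((n + 1 : ℝ) / α) * ((1 - x) ^ 2 / x) * gR α x * (gEps α x) ^ (n + 1)) /
          ((1 - (gEps α x) ^ (n + 1)) *
            ((gR α x - α * (1 + x)) + (gR α x + α * (1 + x)) * (gEps α x) ^ (n + 1))) := by
  obtain ⟨ha1, ha2⟩ := hα
  obtain ⟨hx1, hx2⟩ := hx
  have hpos : 0 < (x - 1) ^ 2 + 4 * α ^ 2 * x := by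
    rcases lt_or_gt_of_ne hx0 with h | h
    · have h3 : 0 < (1 - α) * (1 + α) := mul_pos (by linarith) (by linarith)
      have h4 : 0 < (-x) * ((1 - α) * (1 + α)) := mul_pos (by linarith) h3
      have h5 : 0 < (x + 1) ^ 2 := pow_pos (by linarith) 2
      nlinarith
    · have : 0 < (x - 1) ^ 2 := by
        nlinarith
      positivity
  have hrpos : 0 < gR α x := Real.sqrt_pos.mpr hpos
  have hr2 : gR α x ^ 2 = (x - 1) ^ 2 + 4 * α ^ 2 * x := Real.sq_sqrt hpos.le
  have hphi : gPhi α x ≠ 0 := by unfold gPhi; linarith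
  have hr0 := hrpos.ne'
  have hrd : HasDerivAt (gR α) ((x - 1 + 2 * α ^ 2) / gR α x) x := by
    have h1 : HasDerivAt (fun y : ℝ => (y - 1) ^ 2 + 4 * α ^ 2 * y)
        (2 * (x - 1) + 4 * α ^ 2) x := by
      have := (((hasDerivAt_id x).sub_const 1).pow 2).add ((hasDerivAt_id x).const_mul (4 * α ^ 2))
      refine this.congr_deriv ?_
      simp
    have h2 := h1.sqrt hpos.ne'
    refine h2.congr_deriv ?_
    change _ / (2 * gR α x) = _
    field_simp
    ring
  obtain ⟨rp, hrp⟩ : ∃ rp, rp = (x - 1 + 2 * α ^ 2) / gR α x := ⟨_, rfl⟩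
  rw [← hrp] at hrd
  have hrp' : rp * gR α x = x - 1 + 2 * α ^ 2 := by rw [hrp]; field_simp
  have hphid : HasDerivAt (gPhi α) (1 + rp) x :=
    ((hasDerivAt_id x).add_const 1).add hrd
  have hpsid : HasDerivAt (gPsi α) (1 - rp) x :=
    ((hasDerivAt_id x).add_const 1).sub hrd
  have hepsd : HasDerivAt (gEps α) (gEps α x * ((1 - x) / (x * gR α x))) x := by
    have h := hpsid.div hphid hphi
    refine h.congr_deriv ?_
    have key : (1 - rp) * gPhi α x - gPsi α x * (1 + rp)
        = 4 * (1 - x) * (1 - α ^ 2) / gR α x := by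
      rw [eq_div_iff hr0]; unfold gPhi gPsi
      linear_combination 2 * hr2 - 2 * (x + 1) * hrp'
    have key2 : gPhi α x * gPsi α x = 4 * x * (1 - α ^ 2) := by
      unfold gPhi gPsi
      linear_combination - hr2
    rw [key]
    unfold gEps
    field_simp
    linear_combination - key2
  have hed : HasDerivAt (fun y => gEps α y ^ (n + 1))
      ((n + 1 : ℝ) * gEps α x ^ (n + 1) * (1 - x) / (x * gR α x)) x := by
    refine (hepsd.pow (n + 1)).congr_deriv ?_
    push_cast
    ring
  obtain ⟨ep, hep⟩ : ∃ ep, ep = (n + 1 : ℝ) * gEps α x ^ (n + 1) * (1 - x) / (x * gR α x) :=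
    ⟨_, rfl⟩
  rw [← hep] at hed
  have hep' : ep * (x * gR α x) = (n + 1 : ℝ) * gEps α x ^ (n + 1) * (1 - x) := by
    rw [hep]; field_simp
  have hN := (hphid.sub_const (2 * (1 + α))).sub (hed.mul (hpsid.sub_const (2 * (1 + α))))
  have hlin : HasDerivAt (fun y : ℝ => 2 * (1 + α) * y) (2 * (1 + α)) x := by
    simpa using (hasDerivAt_id x).const_mul (2 * (1 + α))
  have hDd := (hphid.sub hlin).sub (hed.mul (hpsid.sub hlin))
  have hB := (hN.div hDd hD).deriv
  have hBeq : deriv (gB α n) x = _ := hB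
  rw [hBeq]
  have key := aux_ident α x (gR α x) (gEps α x ^ (n + 1)) (n + 1) rp ep hr2 hrp' hep'
  simp only [Pi.sub_apply, Pi.mul_apply]
  unfold gB
  generalize gEps α x ^ (n + 1) = e at *
  simp only [gPhi, gPsi] at *
  clear hN hDd hB hBeq hed hepsd hpsid hphid hrd hlin
  generalize gR α x = r at *
  generalize hDD : x + 1 + r - 2 * (1 + α) * x - e * (x + 1 - r - 2 * (1 + α) * x) = D at *
  generalize hNN : x + 1 + r - 2 * (1 + α) - e * (x + 1 - r - 2 * (1 + α)) = N at *
  generalize hden' : (1 - e) * (r - α * (1 + x) + (r + α * (1 + x)) * e) = d at *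
  have hsq : D ^ 2 - N ^ 2 = 4 * (1 + α) * (1 - x) * d := by
    rw [← hDD, ← hNN, ← hden']; ring
  have h1a : 1 + α ≠ 0 := by linarith
  have h1x : 1 - x ≠ 0 := by linarith
  have h1 : 1 - (N / D) ^ 2 = 4 * (1 + α) * (1 - x) * d / D ^ 2 := by
    rw [← hsq]; field_simp
  rw [h1]
  generalize hW : (1 + rp - (ep * (x + 1 - r - 2 * (1 + α)) + e * (1 - rp))) * D -
      N * (1 + rp - 2 * (1 + α) - (ep * (x + 1 - r - 2 * (1 + α) * x)
          + e * (1 - rp - 2 * (1 + α)))) = W at *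
  have hWe : W = (-4 * (1 + α) * (α * x * (1 - e) * ((r - α * (1 + x)) - (r + α * (1 + x)) * e)
        - (n + 1) * (1 - x) ^ 2 * r * e)) / (x * r) := by
    rw [eq_div_iff (mul_ne_zero hx0 hr0)]; exact key
  rw [hWe]
  field_simp
  ring
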